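/- Let A′ be the set of triples (ξ′, η′, ζ′) ∈ [0,1]³ of the form ξ′ = (μ⊗ν)(x<y) + (1/2)(μ⊗ν)(x=y), η′ = (ν⊗ρ)(y<z) + (1/2)(ν⊗ρ)(y=z), ζ′ = (ρ⊗μ)(z<x) + (1/2)(ρ⊗μ)(z=x), where μ, ν, ρ range over all Borel probability measures on ℝ (ties allowed). Then A′ = D. -/

import Mathlib

open MeasureTheory

/-- The function `α` of Steinhaus and Trybuła. -/
noncomputable def alphaST (ξ η : ℝ) : ℝ :=
  if 1 < ξ + η then max (max ((1 - ξ) / η) ((1 - η) / ξ)) (1 - ξ * η) else 1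

/-- The region `D` of Steinhaus and Trybuła. -/
def DST : Set (ℝ × ℝ × ℝ) :=
  {t | t.1 ∈ Set.Icc (0 : ℝ) 1 ∧ t.2.1 ∈ Set.Icc (0 : ℝ) 1 ∧ t.2.2 ∈ Set.Icc (0 : ℝ) 1 ∧
    1 - alphaST (1 - t.1) (1 - t.2.1) ≤ t.2.2 ∧ t.2.2 ≤ alphaST t.1 t.2.1}

/-- The tie-splitting comparison kernel: `1` if `x < y`, `1 / 2` if `x = y`, and `0` otherwise. -/
noncomputable def halfLT (x y : ℝ) : ℝ := if x < y then 1 else if x = y then 1 / 2 else 0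

lemma halfLT_nonneg (x y : ℝ) : 0 ≤ halfLT x y := by
  unfold halfLT; split_ifs <;> norm_num

lemma halfLT_le_one (x y : ℝ) : halfLT x y ≤ 1 := by
  unfold halfLT; split_ifs <;> norm_num

lemma halfLT_add_swap (x y : ℝ) : halfLT x y + halfLT y x = 1 := by
  unfold halfLT
  rcases lt_trichotomy x y with h | h | h
  · simp [h, h.not_gt, h.ne']
  · norm_num [h]
  · simp [h, h.not_gt, h.ne']

lemma halfLT_mono_right (x : ℝ) : Monotone (halfLT x) := by
  intro y z h
  unfold halfLT
  split_ifs <;> first | (exfalso; grind) | norm_num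

lemma halfLT_anti_left (y : ℝ) : Antitone fun x ↦ halfLT x y := by
  intro x z h
  have h₁ := halfLT_add_swap x y
  have h₂ := halfLT_add_swap z y
  have h₃ := halfLT_mono_right y h
  simp only
  linarith

lemma halfLT_eq_indicator (q : ℝ × ℝ) :
    halfLT q.1 q.2 = {q : ℝ × ℝ | q.1 < q.2}.indicator (fun _ ↦ (1 : ℝ)) q +
      (1 / 2) * {q : ℝ × ℝ | q.1 = q.2}.indicator (fun _ ↦ (1 : ℝ)) q := by
  rcases lt_trichotomy q.1 q.2 with h | h | h
  · simp [halfLT, h, h.ne]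
  · simp [halfLT, h]
  · simp [halfLT, h.not_gt, h.ne']

lemma measurableSet_fst_lt_snd : MeasurableSet {q : ℝ × ℝ | q.1 < q.2} :=
  measurableSet_lt measurable_fst measurable_snd

lemma measurableSet_fst_eq_snd : MeasurableSet {q : ℝ × ℝ | q.1 = q.2} :=
  measurableSet_eq_fun measurable_fst measurable_snd

lemma measurable_halfLT : Measurable fun q : ℝ × ℝ ↦ halfLT q.1 q.2 :=
  Measurable.ite measurableSet_fst_lt_snd measurable_const
    (Measurable.ite measurableSet_fst_eq_snd measurable_const measurable_const)

lemma integrable_halfLT (m : Measure (ℝ × ℝ)) [IsFiniteMeasure m] :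
    Integrable (fun q : ℝ × ℝ ↦ halfLT q.1 q.2) m :=
  .of_bound measurable_halfLT.aestronglyMeasurable 1 <| .of_forall fun q ↦ by
    rw [Real.norm_of_nonneg (halfLT_nonneg _ _)]; exact halfLT_le_one _ _

lemma integrable_halfLT_left (μ : Measure ℝ) [IsFiniteMeasure μ] (y : ℝ) :
    Integrable (fun x ↦ halfLT x y) μ :=
  .of_bound (measurable_halfLT.comp (measurable_id.prodMk measurable_const)).aestronglyMeasurable 1
    <| .of_forall fun q ↦ by
      rw [Real.norm_of_nonneg (halfLT_nonneg _ _)]; exact halfLT_le_one _ _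

lemma integrable_halfLT_right (μ : Measure ℝ) [IsFiniteMeasure μ] (x : ℝ) :
    Integrable (halfLT x) μ :=
  .of_bound (measurable_halfLT.comp (measurable_const.prodMk measurable_id)).aestronglyMeasurable 1
    <| .of_forall fun q ↦ by
      rw [Real.norm_of_nonneg (halfLT_nonneg _ _)]; exact halfLT_le_one _ _

/-- The probability of `x < y` plus half the probability of `x = y` under `μ ⊗ ν`. -/
noncomputable def winProb (μ ν : Measure ℝ) : ℝ :=
  ((μ.prod ν) {q : ℝ × ℝ | q.1 < q.2}).toReal +
    (1 / 2) * ((μ.prod ν) {q : ℝ × ℝ | q.1 = q.2}).toReal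

lemma winProb_eq_integral_prod (μ ν : Measure ℝ) [IsFiniteMeasure μ] [IsFiniteMeasure ν] :
    winProb μ ν = ∫ q, halfLT q.1 q.2 ∂μ.prod ν := by
  simp_rw [halfLT_eq_indicator]
  rw [integral_add, integral_const_mul, integral_indicator_const _ measurableSet_fst_lt_snd,
    integral_indicator_const _ measurableSet_fst_eq_snd]
  · simp [winProb, Measure.real]
  · exact (integrable_const _).indicator measurableSet_fst_lt_snd
  · exact ((integrable_const _).indicator measurableSet_fst_eq_snd).const_mul _

lemma winProb_eq_integral_left (μ ν : Measure ℝ) [IsFiniteMeasure μ] [IsFiniteMeasure ν] :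
    winProb μ ν = ∫ x, ∫ y, halfLT x y ∂ν ∂μ := by
  rw [winProb_eq_integral_prod, integral_prod _ (integrable_halfLT _)]

lemma winProb_eq_integral_right (μ ν : Measure ℝ) [IsFiniteMeasure μ] [IsFiniteMeasure ν] :
    winProb μ ν = ∫ y, ∫ x, halfLT x y ∂μ ∂ν := by
  rw [winProb_eq_integral_prod, integral_prod_symm _ (integrable_halfLT _)]

lemma winProb_add_swap (μ ν : Measure ℝ) [IsProbabilityMeasure μ] [IsProbabilityMeasure ν] :
    winProb μ ν + winProb ν μ = 1 := by
  rw [winProb_eq_integral_left, winProb_eq_integral_right ν μ,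
    ← integral_add (integrable_halfLT (μ.prod ν)).integral_prod_left
      ((integrable_halfLT (ν.prod μ)).integral_prod_right)]
  simp_rw [← integral_add (integrable_halfLT_right ν _) (integrable_halfLT_left ν _),
    halfLT_add_swap]
  simp

lemma winProb_mem_Icc (μ ν : Measure ℝ) [IsProbabilityMeasure μ] [IsProbabilityMeasure ν] :
    winProb μ ν ∈ Set.Icc (0 : ℝ) 1 := by
  have h := winProb_add_swap μ ν
  have h₁ : 0 ≤ winProb μ ν := by unfold winProb; positivity
  have h₂ : 0 ≤ winProb ν μ := by unfold winProb; positivity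
  exact ⟨h₁, by linarith⟩

lemma bilinear_descent {ξ η w r W R B C : ℝ} (hξ : 0 ≤ ξ) (hη : 0 ≤ η) (hB : 0 < B)
    (hw : 0 ≤ w) (hr : 0 ≤ r) (hW : w ≤ W) (hR : r ≤ R)
    (h : B * (ξ * r + η * w) - w * r * C < 0) :
    B * (ξ * R + η * W) - W * R * C ≤ B * (ξ * r + η * w) - w * r * C := by
  have h₁ : B * η - r * C < 0 := by
    by_contra! h'
    have : 0 ≤ w * (B * η - r * C) + B * (ξ * r) := by positivity
    linarith
  have h₂ : B * (ξ * r + η * W) - W * r * C ≤ B * (ξ * r + η * w) - w * r * C := by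
    nlinarith
  have h₃ : B * ξ - W * C < 0 := by
    by_contra! h'
    have hW₀ := hw.trans hW
    have : 0 ≤ r * (B * ξ - W * C) + B * (η * W) := by positivity
    linarith
  nlinarith

lemma area_tail_absurd {ξ η t w r A : ℝ} (hξ : 0 < ξ) (hη : 0 < η)
    (hsum : 1 < ξ + η) (ht₁ : t < 1) (htη : η < t) (hw₀ : 0 ≤ w) (hw₁ : w ≤ 1 - ξ)
    (hr₀ : 0 ≤ r) (hrt : t * r ≤ (1 - t) * η)
    (hA : t * (1 - t) * (ξ * η + ξ * r + η * w) - w * r * (1 - t * (1 - t)) ≤ t * (1 - t) * A)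
    (h₁ : A < ξ * η) (h₂ : A * η < ξ + η - 1) : False := by
  have ht₀ : 0 < t := hη.trans htη
  have ht₁' : 0 < 1 - t := sub_pos.2 ht₁
  have hB : 0 < t * (1 - t) := mul_pos ht₀ ht₁'
  have hR : r ≤ (1 - t) * η / t := by rw [le_div_iff₀ ht₀]; linarith
  have hV : t * (1 - t) * (ξ * r + η * w) - w * r * (1 - t * (1 - t)) < 0 := by nlinarith
  have hm := bilinear_descent hξ.le hη.le hB hw₀ hr₀ hw₁ hR hV
  have hm' : η * (t - (1 - ξ)) ≤ A * t ^ 2 := by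
    have h₃ : t * (1 - t) * (ξ * η) + (t * (1 - t) * (ξ * ((1 - t) * η / t) + η * (1 - ξ)) -
        (1 - ξ) * ((1 - t) * η / t) * (1 - t * (1 - t))) =
        (1 - t) / t * (η * (t - (1 - ξ))) := by field_simp; ring
    have h₄ : (1 - t) / t * (η * (t - (1 - ξ))) ≤ t * (1 - t) * A := by linarith
    rw [div_mul_eq_mul_div, div_le_iff₀ ht₀] at h₄
    refine le_of_mul_le_mul_left (h₄.trans_eq ?_) ht₁'
    ring
  have h₅ : t < (1 - ξ) * (1 + t) := by
    have : η * ((1 - t) * (t - (1 - ξ) * (1 + t))) < 0 := by nlinarith [pow_pos ht₀ 2]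
    by_contra! h
    have h' := sub_nonneg.2 h
    exact this.not_ge (by positivity)
  have h₆ : (1 - ξ) * (η + t) < t * η := by
    have : (t - η) * ((1 - ξ) * (η + t) - t * η) < 0 := by nlinarith [pow_pos ht₀ 2]
    nlinarith
  nlinarith

/-- The two-rectangle area inequality with exactly balanced excesses. -/
lemma area_lower_bound_of_balanced {ξ η t w r A : ℝ} (hξ : 0 < ξ) (hη : 0 < η)
    (hsum : 1 < ξ + η) (ht₀ : 0 < t) (ht₁ : t < 1) (hw₀ : 0 ≤ w) (hw₁ : w ≤ 1 - ξ)
    (hwt : (1 - t) * w ≤ t * ξ) (hr₀ : 0 ≤ r) (hr₁ : r ≤ 1 - η) (hrt : t * r ≤ (1 - t) * η)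
    (hA : t * (1 - t) * (ξ * η + ξ * r + η * w) - w * r * (1 - t * (1 - t)) ≤ t * (1 - t) * A) :
    ξ * η ≤ A ∨ ξ + η - 1 ≤ A * η ∨ ξ + η - 1 ≤ A * ξ := by
  by_contra! hcon
  obtain ⟨h₁, h₂, h₃⟩ := hcon
  have hB : 0 < t * (1 - t) := mul_pos ht₀ (sub_pos.2 ht₁)
  rcases lt_or_ge η t with h | ht_le
  · exact area_tail_absurd hξ hη hsum ht₁ h hw₀ hw₁ hr₀ hrt hA h₁ h₂
  rcases lt_or_ge t (1 - ξ) with h | ht_ge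
  · exact area_tail_absurd (t := 1 - t) (A := A) hη hξ (by linarith) (by linarith) (by linarith)
      hr₀ hr₁ hw₀ (by linarith) (by linarith) (by linarith) (by linarith)
  have hV : t * (1 - t) * (ξ * r + η * w) - w * r * (1 - t * (1 - t)) < 0 := by nlinarith
  have hm := bilinear_descent hξ.le hη.le hB hw₀ hr₀ hw₁ hr₁ hV
  have hm' : t * (1 - t) * (1 - A) ≤ (1 - ξ) * (1 - η) := by linarith
  have hA₁ : 0 < 1 - A := by nlinarith
  rcases le_total (t + η) 1 with h | h
  · have : ξ * (1 - ξ) ≤ t * (1 - t) := by nlinarith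
    have h₄ : ξ * (1 - ξ) * (1 - A) ≤ (1 - ξ) * (1 - η) := by nlinarith
    rcases (hw₀.trans hw₁).eq_or_lt with h₅ | h₅
    · nlinarith
    · nlinarith
  · have : η * (1 - η) ≤ t * (1 - t) := by nlinarith
    have h₄ : η * (1 - η) * (1 - A) ≤ (1 - ξ) * (1 - η) := by nlinarith
    rcases (hr₀.trans hr₁).eq_or_lt with h₅ | h₅
    · nlinarith
    · nlinarith

/-- If a planar point is a convex combination of `(a, b)` and `(c, d)` up to domination, then the
union of the rectangles spanned by these two corners has at least the Steinhaus–Trybuła area. -/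
lemma area_lower_bound {ξ η a b c d : ℝ} (hξ : 0 < ξ) (hη : 0 < η) (hsum : 1 < ξ + η)
    (ha₀ : 0 ≤ a) (ha : a ≤ ξ) (hc : ξ ≤ c) (hc₁ : c ≤ 1) (hd₀ : 0 ≤ d) (hd : d ≤ η)
    (hb : η ≤ b) (hb₁ : b ≤ 1) (h : (ξ - a) * (η - d) ≤ (c - ξ) * (b - η)) :
    ξ * η ≤ a * b + (c - a) * d ∨ ξ + η - 1 ≤ (a * b + (c - a) * d) * η ∨
      ξ + η - 1 ≤ (a * b + (c - a) * d) * ξ := by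
  have hξ₁ : ξ ≤ 1 := hc.trans hc₁
  rcases ha.eq_or_lt with rfl | ha
  · left; nlinarith [mul_nonneg (sub_nonneg.2 hc) hd₀]
  rcases hd.eq_or_lt with rfl | hd
  · left; nlinarith [mul_nonneg ha₀ (sub_nonneg.2 hb)]
  have huv : 0 < (ξ - a) * (η - d) := mul_pos (sub_pos.2 ha) (sub_pos.2 hd)
  have hw : 0 < c - ξ := (sub_nonneg.2 hc).lt_of_ne fun h₀ ↦ by
    rw [← h₀, zero_mul] at h; exact h.not_gt huv
  have hs : 0 < c - a := by linarith
  have hr : (ξ - a) * (η - d) / (c - ξ) ≤ b - η := by rw [div_le_iff₀ hw]; linarith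
  refine area_lower_bound_of_balanced (t := (c - ξ) / (c - a)) (w := c - ξ)
    (r := (ξ - a) * (η - d) / (c - ξ)) hξ hη hsum (by positivity)
    (by rw [div_lt_one hs]; linarith) hw.le (by linarith) ?_ (by positivity) (by linarith) ?_ ?_
  · rw [show (1 - (c - ξ) / (c - a)) * (c - ξ) = (c - ξ) / (c - a) * (ξ - a) by field_simp; ring]
    gcongr
    linarith
  · rw [show (c - ξ) / (c - a) * ((ξ - a) * (η - d) / (c - ξ)) =
      (1 - (c - ξ) / (c - a)) * (η - d) by field_simp; ring]
    gcongr
    · rw [sub_nonneg, div_le_one hs]; linarith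
    · linarith
  · have hB : 0 ≤ (c - ξ) / (c - a) * (1 - (c - ξ) / (c - a)) :=
      mul_nonneg (by positivity) (by rw [sub_nonneg, div_le_one hs]; linarith)
    have hle : a * (η + (ξ - a) * (η - d) / (c - ξ)) + (c - a) * d ≤ a * b + (c - a) * d := by
      gcongr; linarith
    refine le_trans (le_of_eq ?_) (mul_le_mul_of_nonneg_left hle hB)
    field_simp
    ring

/-- A compact planar set meeting every half-plane `(1 - θ) (p₂ - η) + θ (p₁ - ξ) ≥ 0` either
contains a point dominating `(ξ, η)`, or two points one of whose convex combinations does. -/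
lemma exists_dominating_pair {K : Set (ℝ × ℝ)} (hK : IsCompact K) {ξ η : ℝ}
    (h : ∀ θ ∈ Set.Icc (0 : ℝ) 1, ∃ p ∈ K, 0 ≤ (1 - θ) * (p.2 - η) + θ * (p.1 - ξ)) :
    (∃ p ∈ K, ξ ≤ p.1 ∧ η ≤ p.2) ∨
      ∃ p ∈ K, ∃ q ∈ K, p.1 ≤ ξ ∧ η ≤ p.2 ∧ ξ ≤ q.1 ∧ q.2 ≤ η ∧
        (ξ - p.1) * (η - q.2) ≤ (q.1 - ξ) * (p.2 - η) := by
  by_contra! hcon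
  obtain ⟨hdom, hpair⟩ := hcon
  set ℓ : ℝ × (ℝ × ℝ) → ℝ := fun x ↦ (1 - x.1) * (x.2.2 - η) + x.1 * (x.2.1 - ξ) with hℓ
  have hI : IsCompact (Set.Icc (0 : ℝ) 1 ×ˢ K) := isCompact_Icc.prod hK
  set L : Set ℝ := Set.image Prod.fst (Set.Icc (0 : ℝ) 1 ×ˢ K ∩ {x | x.2.1 ≤ ξ ∧ η ≤ x.2.2 ∧ 0 ≤ ℓ x})
  set R : Set ℝ := Set.image Prod.fst (Set.Icc (0 : ℝ) 1 ×ˢ K ∩ {x | ξ ≤ x.2.1 ∧ 0 ≤ ℓ x})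
  have hLc : IsClosed L := by
    refine ((hI.inter_right ?_).image continuous_fst).isClosed
    refine IsClosed.and ?_ (IsClosed.and ?_ ?_) <;>
      exact isClosed_le (by fun_prop) (by fun_prop)
  have hRc : IsClosed R := by
    refine ((hI.inter_right ?_).image continuous_fst).isClosed
    refine IsClosed.and ?_ ?_ <;> exact isClosed_le (by fun_prop) (by fun_prop)
  have hcover : Set.Icc (0 : ℝ) 1 ⊆ L ∪ R := by
    intro θ hθ
    obtain ⟨p, hp, h₀⟩ := h θ hθ
    rcases le_or_gt ξ p.1 with hp₁ | hp₁
    · exact .inr ⟨(θ, p), ⟨⟨hθ, hp⟩, hp₁, h₀⟩, rfl⟩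
    · refine .inl ⟨(θ, p), ⟨⟨hθ, hp⟩, hp₁.le, ?_, h₀⟩, rfl⟩
      simp only
      obtain ⟨hθ₀, hθ₁⟩ := hθ
      by_contra! hp₂
      rcases hθ₀.eq_or_lt with rfl | hθ₀ <;> nlinarith
  have hL : (Set.Icc (0 : ℝ) 1 ∩ L).Nonempty := by
    have h₀ : (0 : ℝ) ∈ Set.Icc (0 : ℝ) 1 := by simp
    refine ⟨0, h₀, (hcover h₀).resolve_right ?_⟩
    rintro ⟨⟨θ, p⟩, ⟨hp, hp₁, hp₂⟩, rfl : θ = 0⟩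
    have := hdom p hp.2 hp₁
    simp [hℓ] at hp₂
    linarith
  have hR : (Set.Icc (0 : ℝ) 1 ∩ R).Nonempty := by
    have h₀ : (1 : ℝ) ∈ Set.Icc (0 : ℝ) 1 := by simp
    refine ⟨1, h₀, (hcover h₀).resolve_left ?_⟩
    rintro ⟨⟨θ, p⟩, ⟨hp, hp₁, hp₂, hp₃⟩, rfl : θ = 1⟩
    have := hdom p hp.2
    simp [hℓ] at hp₂ hp₃
    linarith [this hp₃]
  obtain ⟨θ, -, ⟨⟨θ', p⟩, ⟨hp, hp₁, hp₂, hp₃⟩, rfl : θ' = θ⟩,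
      ⟨⟨θ'', q⟩, ⟨hq, hq₁, hq₃⟩, rfl : θ'' = θ'⟩⟩ :=
    isPreconnected_closed_iff.1 isPreconnected_Icc L R hLc hRc hcover hL hR
  obtain ⟨⟨hθ₀, hθ₁⟩, hpK⟩ := hp
  simp only [hℓ] at *
  have hq₂ := hdom q hq.2 hq₁
  refine (hpair p hpK q hq.2 hp₁ hp₂ hq₁ hq₂.le).not_ge ?_
  rcases hθ₁.eq_or_lt with rfl | hθ₁
  · have : ξ ≤ p.1 := by linarith
    nlinarith
  rcases hθ₀.eq_or_lt with rfl | hθ₀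
  · linarith
  have hmul : (θ'' * (ξ - p.1)) * ((1 - θ'') * (η - q.2)) ≤
      ((1 - θ'') * (p.2 - η)) * (θ'' * (q.1 - ξ)) :=
    mul_le_mul (by linarith) (by linarith)
      (mul_nonneg (sub_pos.2 hθ₁).le (sub_pos.2 hq₂).le)
      (mul_nonneg (sub_pos.2 hθ₁).le (sub_nonneg.2 hp₂))
  refine le_of_mul_le_mul_left (?_ : θ'' * (1 - θ'') * _ ≤ _) (mul_pos hθ₀ (sub_pos.2 hθ₁))
  linarith

lemma rectangle_union_le_winProb (μ ρ : Measure ℝ) [IsProbabilityMeasure μ]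
    [IsProbabilityMeasure ρ] {y z : ℝ} (hyz : y ≤ z) :
    (∫ x, halfLT x y ∂μ) * (∫ x, halfLT y x ∂ρ) +
      ((∫ x, halfLT x z ∂μ) - ∫ x, halfLT x y ∂μ) * (∫ x, halfLT z x ∂ρ) ≤ winProb μ ρ := by
  have hy := integrable_halfLT_left μ y
  have hz := integrable_halfLT_left μ z
  have hzy : Integrable (fun x ↦ halfLT x z - halfLT x y) μ := hz.sub hy
  have hanti : Antitone fun x ↦ ∫ s, halfLT x s ∂ρ := fun x x' hx ↦
    integral_mono (integrable_halfLT_right ρ x') (integrable_halfLT_right ρ x)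
      fun s ↦ halfLT_anti_left s hx
  have hnonneg (x : ℝ) : 0 ≤ ∫ s, halfLT x s ∂ρ := integral_nonneg fun s ↦ halfLT_nonneg _ _
  rw [winProb_eq_integral_left, ← integral_sub hz hy, ← integral_mul_const, ← integral_mul_const,
    ← integral_add (hy.mul_const _) (hzy.mul_const _)]
  refine integral_mono ((hy.mul_const _).add (hzy.mul_const _))
    (integrable_halfLT (μ.prod ρ)).integral_prod_left fun x ↦ ?_
  have hyz' := hanti hyz
  have hx := hnonneg x
  simp only at hyz' ⊢
  rcases lt_trichotomy x y with h | rfl | h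
  · have := hanti h.le
    simp only at this
    simpa [halfLT, h, h.trans_le hyz] using this
  · rcases hyz.eq_or_lt with rfl | h
    · simp [halfLT] at hx ⊢; linarith
    · simp [halfLT, h] at hx hyz' ⊢; linarith
  · rcases lt_trichotomy x z with h' | rfl | h'
    · have := hanti h'.le
      simp only at this
      simpa [halfLT, h', h.not_gt, h.ne'] using this
    · simp [halfLT, h.not_gt, h.ne'] at hx ⊢; linarith
    · simpa [halfLT, h.not_gt, h.ne', h'.not_gt, h'.ne'] using hx

lemma winProb_le_alphaST (μ ν ρ : Measure ℝ) [IsProbabilityMeasure μ] [IsProbabilityMeasure ν]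
    [IsProbabilityMeasure ρ] : winProb ρ μ ≤ alphaST (winProb μ ν) (winProb ν ρ) := by
  rw [alphaST]
  split_ifs with hsum
  swap
  · exact (winProb_mem_Icc _ _).2
  set ξ := winProb μ ν with hξ_def
  set η := winProb ν ρ with hη_def
  have hξ₁ := (winProb_mem_Icc μ ν).2
  have hη₁ := (winProb_mem_Icc ν ρ).2
  have hξ : 0 < ξ := by linarith
  have hη : 0 < η := by linarith
  have hζ : winProb ρ μ = 1 - winProb μ ρ := by linarith [winProb_add_swap μ ρ]
  set A := winProb μ ρ
  suffices h : ξ * η ≤ A ∨ ξ + η - 1 ≤ A * η ∨ ξ + η - 1 ≤ A * ξ by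
    rw [hζ, le_max_iff, le_max_iff, le_div_iff₀ hη, le_div_iff₀ hξ]
    rcases h with h | h | h
    · right; linarith
    · left; left; linarith
    · left; right; linarith
  set γ : ℝ → ℝ × ℝ := fun y ↦ (∫ x, halfLT x y ∂μ, ∫ x, halfLT y x ∂ρ) with hγ
  have hγ_mem (y : ℝ) : γ y ∈ Set.Icc (0 : ℝ × ℝ) 1 := by
    refine ⟨⟨integral_nonneg fun _ ↦ halfLT_nonneg _ _,
      integral_nonneg fun _ ↦ halfLT_nonneg _ _⟩, ?_, ?_⟩
    · simpa using integral_mono (integrable_halfLT_left μ y) (integrable_const 1)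
        fun _ ↦ halfLT_le_one _ _
    · simpa using integral_mono (integrable_halfLT_right ρ y) (integrable_const 1)
        fun _ ↦ halfLT_le_one _ _
  set K := closure (Set.range γ)
  have hK_sub : K ⊆ Set.Icc (0 : ℝ × ℝ) 1 :=
    closure_minimal (Set.range_subset_iff.2 hγ_mem) isClosed_Icc
  have hK : IsCompact K := isCompact_Icc.of_isClosed_subset isClosed_closure hK_sub
  have hpair : ∀ p ∈ K, ∀ q ∈ K,
      p.1 * p.2 + q.1 * q.2 - min p.1 q.1 * min p.2 q.2 ≤ A := by
    have hrange : ∀ y z, y ≤ z → (γ y).1 * (γ y).2 + (γ z).1 * (γ z).2 -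
        min (γ y).1 (γ z).1 * min (γ y).2 (γ z).2 ≤ A := by
      intro y z hyz
      rw [min_eq_left (integral_mono (integrable_halfLT_left μ y) (integrable_halfLT_left μ z)
          fun x ↦ halfLT_mono_right x hyz),
        min_eq_right (integral_mono (integrable_halfLT_right ρ z) (integrable_halfLT_right ρ y)
          fun x ↦ halfLT_anti_left x hyz)]
      have := rectangle_union_le_winProb μ ρ hyz
      simp only [hγ]
      linarith
    intro p hp q hq
    have hclosed : IsClosed {x : (ℝ × ℝ) × (ℝ × ℝ) |
        x.1.1 * x.1.2 + x.2.1 * x.2.2 - min x.1.1 x.2.1 * min x.1.2 x.2.2 ≤ A} :=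
      isClosed_le (by fun_prop) (by fun_prop)
    have hmem : (p, q) ∈ closure (Set.range γ ×ˢ Set.range γ) := by
      rw [closure_prod_eq]; exact ⟨hp, hq⟩
    refine closure_minimal ?_ hclosed hmem
    rintro ⟨-, -⟩ ⟨⟨y, rfl⟩, ⟨z, rfl⟩⟩
    rcases le_total y z with hyz | hyz
    · exact hrange y z hyz
    · have := hrange z y hyz
      rw [min_comm (γ z).1, min_comm (γ z).2] at this
      simp only [Set.mem_ofPred_eq]
      linarith
  have hhalf : ∀ θ ∈ Set.Icc (0 : ℝ) 1,
      ∃ p ∈ K, 0 ≤ (1 - θ) * (p.2 - η) + θ * (p.1 - ξ) := by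
    intro θ _
    have hf : Integrable (fun y ↦ (γ y).1) ν := (integrable_halfLT (μ.prod ν)).integral_prod_right
    have hg : Integrable (fun y ↦ (γ y).2) ν := (integrable_halfLT (ν.prod ρ)).integral_prod_left
    have hint : Integrable (fun y ↦ (1 - θ) * (γ y).2 + θ * (γ y).1) ν :=
      (hg.const_mul _).add (hf.const_mul _)
    obtain ⟨y, hy⟩ := exists_integral_le hint
    rw [integral_add (hg.const_mul _) (hf.const_mul _), integral_const_mul, integral_const_mul,
      ← winProb_eq_integral_left, ← winProb_eq_integral_right, ← hξ_def, ← hη_def] at hy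
    exact ⟨γ y, subset_closure ⟨y, rfl⟩, by linarith⟩
  rcases exists_dominating_pair hK hhalf with ⟨p, hp, hp₁, hp₂⟩ |
    ⟨p, hp, q, hq, hp₁, hp₂, hq₁, hq₂, h⟩
  · left
    have h := hpair p hp p hp
    rw [min_self, min_self] at h
    nlinarith
  · have h' := hpair p hp q hq
    rw [min_eq_left (hp₁.trans hq₁), min_eq_right (hq₂.trans hp₂)] at h'
    have h'' : p.1 * p.2 + (q.1 - p.1) * q.2 ≤ A := by linarith
    have hpm := hK_sub hp
    have hqm := hK_sub hq
    rcases area_lower_bound hξ hη hsum hpm.1.1 hp₁ hq₁ hqm.2.1 hqm.1.2 hq₂ hp₂ hpm.2.2 h with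
      h | h | h
    · exact .inl (h.trans h'')
    · exact .inr (.inl (h.trans (by gcongr)))
    · exact .inr (.inr (h.trans (by gcongr)))

lemma alphaST_comm (ξ η : ℝ) : alphaST ξ η = alphaST η ξ := by
  simp only [alphaST, add_comm ξ η, mul_comm ξ η, max_comm ((1 - ξ) / η)]

lemma winProb_mem_DST (μ ν ρ : Measure ℝ) [IsProbabilityMeasure μ] [IsProbabilityMeasure ν]
    [IsProbabilityMeasure ρ] : (winProb μ ν, winProb ν ρ, winProb ρ μ) ∈ DST := by
  refine ⟨winProb_mem_Icc _ _, winProb_mem_Icc _ _, winProb_mem_Icc _ _, ?_,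
    winProb_le_alphaST _ _ _⟩
  have h := winProb_le_alphaST ρ ν μ
  have h₁ := winProb_add_swap μ ν
  have h₂ := winProb_add_swap ν ρ
  have h₃ := winProb_add_swap ρ μ
  rw [alphaST_comm] at h
  rw [show 1 - (winProb μ ν, winProb ν ρ, winProb ρ μ).1 = winProb ν μ by simp; linarith,
    show 1 - (winProb μ ν, winProb ν ρ, winProb ρ μ).2.1 = winProb ρ ν by simp; linarith]
  simp only
  linarith

/-- The finitely supported measure with mass `w i` at `x i`. -/
noncomputable def atomic {n : ℕ} (w x : Fin n → ℝ) : Measure ℝ :=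
  ∑ i, ENNReal.ofReal (w i) • Measure.dirac (x i)

instance {n : ℕ} (w x : Fin n → ℝ) : IsFiniteMeasure (atomic w x) :=
  ⟨by simp [atomic, Measure.finsetSum_apply, ENNReal.sum_lt_top]⟩

lemma isProbabilityMeasure_atomic {n : ℕ} {w x : Fin n → ℝ} (hw : ∀ i, 0 ≤ w i)
    (h : ∑ i, w i = 1) : IsProbabilityMeasure (atomic w x) := by
  constructor
  simp [atomic, Measure.finsetSum_apply, ← ENNReal.ofReal_sum_of_nonneg fun i _ ↦ hw i, h]

lemma integral_atomic {n : ℕ} {w x : Fin n → ℝ} (hw : ∀ i, 0 ≤ w i) (f : ℝ → ℝ) :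
    ∫ y, f y ∂atomic w x = ∑ i, w i * f (x i) := by
  unfold atomic
  rw [integral_finsetSum_measure]
  · simp [integral_smul_measure, hw]
  · intro i _
    exact (integrable_dirac (by simp)).smul_measure (by simp)

lemma winProb_atomic {m n : ℕ} {w x : Fin m → ℝ} {v y : Fin n → ℝ} (hw : ∀ i, 0 ≤ w i)
    (hv : ∀ i, 0 ≤ v i) :
    winProb (atomic w x) (atomic v y) = ∑ i, w i * ∑ j, v j * halfLT (x i) (y j) := by
  rw [winProb_eq_integral_left, integral_atomic hw]
  simp_rw [integral_atomic hv]

/-- The triples of winning probabilities of three independent real random variables. -/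
def IsWinTriple (ξ η ζ : ℝ) : Prop :=
  ∃ μ ν ρ : Measure ℝ, IsProbabilityMeasure μ ∧ IsProbabilityMeasure ν ∧ IsProbabilityMeasure ρ ∧
    winProb μ ν = ξ ∧ winProb ν ρ = η ∧ winProb ρ μ = ζ

lemma IsWinTriple.of_atomic {l m n : ℕ} {u x : Fin l → ℝ} {v y : Fin m → ℝ} {w z : Fin n → ℝ}
    {ξ η ζ : ℝ} (hu : ∀ i, 0 ≤ u i) (hv : ∀ i, 0 ≤ v i) (hw : ∀ i, 0 ≤ w i)
    (hu₁ : ∑ i, u i = 1) (hv₁ : ∑ i, v i = 1) (hw₁ : ∑ i, w i = 1)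
    (hξ : ∑ i, u i * ∑ j, v j * halfLT (x i) (y j) = ξ)
    (hη : ∑ i, v i * ∑ j, w j * halfLT (y i) (z j) = η)
    (hζ : ∑ i, w i * ∑ j, u j * halfLT (z i) (x j) = ζ) : IsWinTriple ξ η ζ :=
  ⟨atomic u x, atomic v y, atomic w z, isProbabilityMeasure_atomic hu hu₁,
    isProbabilityMeasure_atomic hv hv₁, isProbabilityMeasure_atomic hw hw₁,
    by rw [winProb_atomic hu hv, hξ], by rw [winProb_atomic hv hw, hη],
    by rw [winProb_atomic hw hu, hζ]⟩

lemma isWinTriple_of_le_div_right {ξ η ζ : ℝ} (hη : 0 < η) (hη₁ : η ≤ 1)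
    (hsum : 1 ≤ ξ + η) (hζ₀ : 0 ≤ ζ) (hζ : ζ ≤ (1 - ξ) / η) : IsWinTriple ξ η ζ := by
  have h₁ : (1 - ξ) / η ≤ 1 := by rw [div_le_one hη]; linarith
  refine .of_atomic (u := ![1 - (1 - ξ) / η, (1 - ξ) / η - ζ, ζ]) (x := ![0, 2, 4])
    (v := ![η, 1 - η]) (y := ![1, 5]) (w := ![1]) (z := ![3]) ?_ ?_ ?_ ?_ ?_ ?_ ?_ ?_ ?_
  · simp [Fin.forall_fin_succ]; grind
  · simp [Fin.forall_fin_succ]; grind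
  · simp
  · simp [Fin.sum_univ_succ]
  · simp [Fin.sum_univ_succ]
  · simp
  · norm_num [Fin.sum_univ_succ, halfLT]; field_simp; ring
  · norm_num [Fin.sum_univ_succ, halfLT]
  · norm_num [Fin.sum_univ_succ, halfLT]

lemma isWinTriple_of_le_div_left {ξ η ζ : ℝ} (hξ : 0 < ξ) (hξ₁ : ξ ≤ 1)
    (hsum : 1 ≤ ξ + η) (hζ₀ : 0 ≤ ζ) (hζ : ζ ≤ (1 - η) / ξ) : IsWinTriple ξ η ζ := by
  have h₁ : (1 - η) / ξ ≤ 1 := by rw [div_le_one hξ]; linarith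
  refine .of_atomic (u := ![1]) (x := ![3])
    (v := ![1 - ξ, ξ]) (y := ![1, 5])
    (w := ![ζ, (1 - η) / ξ - ζ, 1 - (1 - η) / ξ]) (z := ![2, 4, 6]) ?_ ?_ ?_ ?_ ?_ ?_ ?_ ?_ ?_
  · simp
  · simp [Fin.forall_fin_succ]; grind
  · simp [Fin.forall_fin_succ]; grind
  · simp
  · simp [Fin.sum_univ_succ]
  · simp [Fin.sum_univ_succ]
  · norm_num [Fin.sum_univ_succ, halfLT]
  · norm_num [Fin.sum_univ_succ, halfLT]; field_simp; ring
  · norm_num [Fin.sum_univ_succ, halfLT]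

lemma isWinTriple_of_le_one_sub_mul {ξ η ζ : ℝ} (hξ : ξ ∈ Set.Icc (0 : ℝ) 1)
    (hη : η ∈ Set.Icc (0 : ℝ) 1) (hζ₀ : (1 - ξ) * (1 - η) ≤ ζ) (hζ : ζ ≤ 1 - ξ * η) :
    IsWinTriple ξ η ζ := by
  obtain ⟨s, hs₀, hs₁, hs⟩ : ∃ s : ℝ, 0 ≤ s ∧ s ≤ 1 ∧
      (1 - ξ) * (1 - η) + s * ((1 - ξ * η) - (1 - ξ) * (1 - η)) = ζ := by
    have hc : ζ ∈ segment ℝ ((1 - ξ) * (1 - η)) (1 - ξ * η) := by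
      rw [segment_eq_Icc (hζ₀.trans hζ)]; exact ⟨hζ₀, hζ⟩
    rw [segment_eq_image'] at hc
    obtain ⟨s, hs, h⟩ := hc
    exact ⟨s, hs.1, hs.2, by simpa using h⟩
  obtain ⟨hξ₀, hξ₁⟩ := hξ
  obtain ⟨hη₀, hη₁⟩ := hη
  have := sub_nonneg.2 hs₁
  have := sub_nonneg.2 hξ₁
  have := sub_nonneg.2 hη₁
  refine .of_atomic (u := ![ξ, 1 - ξ]) (x := ![2, 6]) (v := ![1]) (y := ![4])
    (w := ![(1 - η) * s, (1 - η) * (1 - s), η * s, η * (1 - s)]) (z := ![1, 3, 5, 7])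
    ?_ ?_ ?_ ?_ ?_ ?_ ?_ ?_ ?_
  · simp [Fin.forall_fin_succ]; grind
  · simp
  · simp only [Fin.forall_fin_succ]; simp; refine ⟨?_, ?_, ?_, ?_⟩ <;> positivity
  · simp [Fin.sum_univ_succ]
  · simp
  · simp [Fin.sum_univ_succ]; ring
  · norm_num [Fin.sum_univ_succ, halfLT]
  · norm_num [Fin.sum_univ_succ, halfLT]; ring
  · norm_num [Fin.sum_univ_succ, halfLT]; rw [← hs]; ring

lemma isWinTriple_of_one_le_add {ξ η ζ : ℝ} (hξ : ξ ∈ Set.Icc (0 : ℝ) 1)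
    (hη : η ∈ Set.Icc (0 : ℝ) 1) (hζ : ζ ∈ Set.Icc (0 : ℝ) 1) (hsum : 1 ≤ ξ + η)
    (h : ζ ≤ alphaST ξ η) : IsWinTriple ξ η ζ := by
  rcases hsum.eq_or_lt with hs | hs
  · rcases hη.1.eq_or_lt with h₀ | h₀
    · refine isWinTriple_of_le_div_left (by linarith) hξ.2 hsum hζ.1 ?_
      rw [show ξ = 1 by linarith, ← h₀]; simpa using hζ.2
    · refine isWinTriple_of_le_div_right h₀ hη.2 hsum hζ.1 ?_
      rw [show 1 - ξ = η by linarith, div_self h₀.ne']; exact hζ.2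
  · have hξ₀ : 0 < ξ := by linarith [hη.2]
    have hη₀ : 0 < η := by linarith [hξ.2]
    rw [alphaST, if_pos hs, le_max_iff, le_max_iff] at h
    by_cases h₁ : ζ ≤ (1 - ξ) / η
    · exact isWinTriple_of_le_div_right hη₀ hη.2 hsum hζ.1 h₁
    by_cases h₂ : ζ ≤ (1 - η) / ξ
    · exact isWinTriple_of_le_div_left hξ₀ hξ.2 hsum hζ.1 h₂
    refine isWinTriple_of_le_one_sub_mul hξ hη ?_ (by tauto)
    have h₃ : 1 - ξ ≤ (1 - ξ) / η := by
      rw [le_div_iff₀ hη₀]; nlinarith [hξ.2, hη.2]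
    nlinarith [hξ.2, hη.2]

lemma IsWinTriple.reflect {ξ η ζ : ℝ} (h : IsWinTriple (1 - η) (1 - ξ) (1 - ζ)) :
    IsWinTriple ξ η ζ := by
  obtain ⟨μ, ν, ρ, hμ, hν, hρ, h₁, h₂, h₃⟩ := h
  exact ⟨ρ, ν, μ, hρ, hν, hμ, by linarith [winProb_add_swap ν ρ],
    by linarith [winProb_add_swap μ ν], by linarith [winProb_add_swap ρ μ]⟩

lemma isWinTriple_of_mem_DST {ξ η ζ : ℝ} (h : (ξ, η, ζ) ∈ DST) : IsWinTriple ξ η ζ := by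
  obtain ⟨hξ, hη, hζ, hl, hu⟩ := h
  simp only at hξ hη hζ hl hu
  rcases le_total 1 (ξ + η) with hs | hs
  · exact isWinTriple_of_one_le_add hξ hη hζ hs hu
  · rw [alphaST_comm] at hl
    exact (isWinTriple_of_one_le_add ⟨by linarith [hη.2], by linarith [hη.1]⟩
      ⟨by linarith [hξ.2], by linarith [hξ.1]⟩ ⟨by linarith [hζ.2], by linarith [hζ.1]⟩
      (by linarith) (by linarith)).reflect

/-- **Steinhaus–Trybuła with ties.** The set `A'` of triples
`(P(X<Y) + P(X=Y)/2, P(Y<Z) + P(Y=Z)/2, P(Z<X) + P(Z=X)/2)` over independent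
real random variables (ties allowed) equals `D`. -/
theorem steinhaus_trybula_with_ties :
    {t : ℝ × ℝ × ℝ | ∃ μ ν ρ : Measure ℝ,
      IsProbabilityMeasure μ ∧ IsProbabilityMeasure ν ∧ IsProbabilityMeasure ρ ∧
      t = (((μ.prod ν) {q : ℝ × ℝ | q.1 < q.2}).toReal +
             (1 / 2) * ((μ.prod ν) {q : ℝ × ℝ | q.1 = q.2}).toReal,
           ((ν.prod ρ) {q : ℝ × ℝ | q.1 < q.2}).toReal +
             (1 / 2) * ((ν.prod ρ) {q : ℝ × ℝ | q.1 = q.2}).toReal,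
           ((ρ.prod μ) {q : ℝ × ℝ | q.1 < q.2}).toReal +
             (1 / 2) * ((ρ.prod μ) {q : ℝ × ℝ | q.1 = q.2}).toReal)} = DST := by
  ext ⟨ξ, η, ζ⟩
  constructor
  · rintro ⟨μ, ν, ρ, hμ, hν, hρ, h⟩
    rw [h]
    exact winProb_mem_DST μ ν ρ
  · intro h
    obtain ⟨μ, ν, ρ, hμ, hν, hρ, rfl, rfl, rfl⟩ := isWinTriple_of_mem_DST h
    exact ⟨μ, ν, ρ, hμ, hν, hρ, rfl⟩
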